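/- (Proposition 3.3, finite form) Let (S_α)_{α ∈ ℕ^d} be square-integrable real random variables, let n ∈ ℕ, and let N be an ℕ-valued random variable independent of the family (S_α), with P(N ≥ m) > 0 for all m ∈ {0,…,n}. Write S̄_m = S_{(m,…,m)} for m ≥ 0 and S̄_{−1} = 0. Then the partial estimator Z̄'_n = Σ_{α ∈ I_0^n} ΔS_α · 1_{{N ≥ |α|_∞}} / P(N ≥ |α|_∞) satisfies E[(Z̄'_n)²] = Σ_{α ∈ I_0^n} E[ΔS_α (2 S̄_n − S̄_{|α|_∞} − S̄_{|α|_∞ − 1})] / P(N ≥ |α|_∞). -/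

import Mathlib

open MeasureTheory ProbabilityTheory

/-- The `i`-th difference operator: `(Δ_i S)_α = S_α − S_{α−e_i}` if `α_i > 0`,
and `(Δ_i S)_α = S_α` if `α_i = 0`. -/
def diffOp {d : ℕ} {V : Type*} [AddCommGroup V] [Module ℝ V]
    (i : Fin d) (S : (Fin d → ℕ) → V) : (Fin d → ℕ) → V :=
  fun α => if α i = 0 then S α else S α - S (Function.update α i (α i - 1))

/-- The mixed difference operator `Δ = Δ_1 ∘ ⋯ ∘ Δ_d`. -/
def mixedDiff {d : ℕ} {V : Type*} [AddCommGroup V] [Module ℝ V]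
    (S : (Fin d → ℕ) → V) : (Fin d → ℕ) → V :=
  (List.finRange d).foldr (fun i T => diffOp i T) S

theorem sum_range_diffOp_update {d : ℕ} {V : Type*} [AddCommGroup V] [Module ℝ V]
    (i : Fin d) (S : (Fin d → ℕ) → V) (α : Fin d → ℕ) (k : ℕ) :
    ∑ j ∈ Finset.range (k + 1), diffOp i S (Function.update α i j) = S (Function.update α i k) := by
  induction k with
  | zero => simp [diffOp]
  | succ k ih => rw [Finset.sum_range_succ, ih]; simp [diffOp]

/-- Iterated differences along the directions of `l` telescope over the box below `γ` spanned by
these directions. -/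
theorem sum_foldr_diffOp {d : ℕ} {V : Type*} [AddCommGroup V] [Module ℝ V]
    (S : (Fin d → ℕ) → V) (γ : Fin d → ℕ) (l : List (Fin d)) (hl : l.Nodup) :
    ∑ α ∈ (Finset.Iic γ).filter (fun α => ∀ j, j ∉ l → α j = γ j),
      l.foldr (fun i T => diffOp i T) S α = S γ := by
  induction l with
  | nil =>
    have : (Finset.Iic γ).filter (fun α => ∀ j, j ∉ ([] : List (Fin d)) → α j = γ j) = {γ} := by
      ext α
      simp only [Finset.mem_filter, Finset.mem_Iic, List.not_mem_nil, not_false_eq_true,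
        forall_const, Finset.mem_singleton]
      exact ⟨fun h => funext h.2, fun h => by simp [h]⟩
    rw [this]
    simp
  | cons i l ih =>
    rw [List.nodup_cons] at hl
    obtain ⟨hi, hl⟩ := hl
    rw [List.foldr_cons, ← ih hl]
    set T := l.foldr (fun i T => diffOp i T) S
    have key : ∀ α ∈ (Finset.Iic γ).filter (fun α => ∀ j, j ∉ l → α j = γ j),
        T α = ∑ k ∈ Finset.range (γ i + 1), diffOp i T (Function.update α i k) := by
      intro α hα
      rw [sum_range_diffOp_update, ← (Finset.mem_filter.1 hα).2 i hi, Function.update_eq_self]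
    rw [Finset.sum_congr rfl key, ← Finset.sum_product']
    symm
    refine Finset.sum_nbij' (fun x => Function.update x.1 i x.2)
      (fun α => (Function.update α i (γ i), α i)) ?_ ?_ ?_ ?_ ?_
    · rintro ⟨α, k⟩ h
      simp only [Finset.mem_product, Finset.mem_filter, Finset.mem_Iic, Finset.mem_range,
        Pi.le_def, List.mem_cons, not_or] at h ⊢
      refine ⟨fun j => ?_, fun j hj => ?_⟩
      · by_cases hji : j = i
        · subst hji; simp; omega
        · simpa [hji] using h.1.1 j
      · simpa [hj.1] using h.1.2 j hj.2
    · intro α h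
      simp only [Finset.mem_product, Finset.mem_filter, Finset.mem_Iic, Finset.mem_range,
        Pi.le_def, List.mem_cons, not_or] at h ⊢
      refine ⟨⟨fun j => ?_, fun j hj => ?_⟩, Nat.lt_succ_of_le (h.1 i)⟩
      · by_cases hji : j = i
        · subst hji; simp
        · simpa [hji] using h.1 j
      · by_cases hji : j = i
        · subst hji; simp
        · simpa [hji] using h.2 j ⟨hji, hj⟩
    · rintro ⟨α, k⟩ h
      simp only [Finset.mem_product, Finset.mem_filter] at h
      simp [← h.1.2 i hi]
    · intro α _
      simp
    · intro x _
      rfl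

theorem sum_Iic_mixedDiff {d : ℕ} {V : Type*} [AddCommGroup V] [Module ℝ V]
    (S : (Fin d → ℕ) → V) (γ : Fin d → ℕ) : ∑ α ∈ Finset.Iic γ, mixedDiff S α = S γ := by
  have h := sum_foldr_diffOp S γ (List.finRange d) (List.nodup_finRange d)
  simpa [mixedDiff] using h

/-- The diagonal of `S`, shifted by one so that the value at `0` is `0`. -/
def shiftedDiag {d : ℕ} (S : (Fin d → ℕ) → ℝ) (m : ℕ) : ℝ :=
  if m = 0 then 0 else S (fun _ => m - 1)

theorem sum_mixedDiff_sup_lt {d : ℕ} (S : (Fin d → ℕ) → ℝ) {n m : ℕ} (hm : m ≤ n + 1) :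
    ∑ α ∈ (Finset.Iic ((fun _ => n) : Fin d → ℕ)).filter (fun α => Finset.univ.sup α < m),
      mixedDiff S α = shiftedDiag S m := by
  cases m with
  | zero => simp [shiftedDiag]
  | succ m =>
    rw [shiftedDiag, if_neg (Nat.succ_ne_zero m), Nat.add_sub_cancel,
      ← sum_Iic_mixedDiff S fun _ => m]
    refine Finset.sum_congr ?_ fun _ _ => rfl
    ext α
    simp only [Finset.mem_filter, Finset.mem_Iic, Pi.le_def, Nat.lt_succ_iff, Finset.sup_le_iff,
      Finset.mem_univ, true_imp_iff]
    exact ⟨fun h => h.2, fun h => ⟨fun i => (h i).trans (by omega), h⟩⟩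

theorem sum_mixedDiff_sup_eq {d : ℕ} (S : (Fin d → ℕ) → ℝ) {n m : ℕ} (hm : m ≤ n) :
    ∑ α ∈ (Finset.Iic ((fun _ => n) : Fin d → ℕ)).filter (fun α => Finset.univ.sup α = m),
      mixedDiff S α = shiftedDiag S (m + 1) - shiftedDiag S m := by
  rw [← sum_mixedDiff_sup_lt S (Nat.succ_le_succ hm), ← sum_mixedDiff_sup_lt S (hm.trans n.le_succ),
    eq_sub_iff_add_eq, ← Finset.sum_union]
  · refine Finset.sum_congr ?_ fun _ _ => rfl
    ext α
    simp only [Finset.mem_union, Finset.mem_filter]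
    rw [Nat.lt_succ_iff, le_iff_lt_or_eq]
    tauto
  · rw [Finset.disjoint_filter]
    intro α _ h
    exact h.not_lt

/-- Summation over a cube, grouped by the value of the maximum norm. -/
theorem sum_mixedDiff_mul_sup {d : ℕ} (S : (Fin d → ℕ) → ℝ) (n : ℕ) (f : ℕ → ℝ) :
    ∑ α ∈ Finset.Iic ((fun _ => n) : Fin d → ℕ), mixedDiff S α * f (Finset.univ.sup α)
      = ∑ m ∈ Finset.range (n + 1), (shiftedDiag S (m + 1) - shiftedDiag S m) * f m := by
  have hmaps : ∀ α ∈ Finset.Iic ((fun _ => n) : Fin d → ℕ),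
      Finset.univ.sup α ∈ Finset.range (n + 1) := by
    intro α hα
    rw [Finset.mem_range, Nat.lt_succ_iff]
    exact Finset.sup_le fun i _ => Finset.mem_Iic.1 hα i
  rw [← Finset.sum_fiberwise_of_maps_to hmaps]
  refine Finset.sum_congr rfl fun m hm => ?_
  rw [← sum_mixedDiff_sup_eq S (Nat.lt_succ_iff.1 (Finset.mem_range.1 hm)), Finset.sum_mul]
  refine Finset.sum_congr rfl fun α hα => ?_
  rw [(Finset.mem_filter.1 hα).2]

theorem sum_symm_div_min {A : ℕ → ℕ → ℝ} (hA : ∀ m k, A m k = A k m) (p : ℕ → ℝ) (n : ℕ) :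
    ∑ m ∈ Finset.range n, ∑ k ∈ Finset.range n, A m k / p (min m k)
      = ∑ m ∈ Finset.range n, (A m m + 2 * ∑ k ∈ Finset.Ico (m + 1) n, A m k) / p m := by
  induction n with
  | zero => simp
  | succ n ih =>
    have h1 : ∀ m ∈ Finset.range n, A m n / p (min m n) = A m n / p m := fun m hm => by
      rw [min_eq_left (Finset.mem_range.1 hm).le]
    have h2 : ∀ k ∈ Finset.range n, A n k / p (min n k) = A k n / p k := fun k hk => by
      rw [min_eq_right (Finset.mem_range.1 hk).le, hA]
    have h3 : ∀ m ∈ Finset.range n,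
        (A m m + 2 * ∑ k ∈ Finset.Ico (m + 1) (n + 1), A m k) / p m
          = (A m m + 2 * ∑ k ∈ Finset.Ico (m + 1) n, A m k) / p m + 2 * (A m n / p m) :=
      fun m hm => by
        rw [Finset.sum_Ico_succ_top (Finset.mem_range.1 hm)]; ring
    simp only [Finset.sum_range_succ, Finset.sum_add_distrib]
    rw [ih, Finset.sum_congr rfl h1, Finset.sum_congr rfl h2, Finset.sum_congr rfl h3,
      Finset.sum_add_distrib, ← Finset.mul_sum]
    simp
    ring

theorem memLp_mixedDiff {d : ℕ} {Ω : Type*} [MeasurableSpace Ω] {μ : Measure Ω}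
    {p : ENNReal} {S : (Fin d → ℕ) → Ω → ℝ} (hS : ∀ α, MemLp (S α) p μ) (α : Fin d → ℕ) :
    MemLp (fun ω => mixedDiff (fun β => S β ω) α) p μ := by
  unfold mixedDiff
  induction List.finRange d generalizing α with
  | nil => exact hS α
  | cons i l ih =>
    simp only [List.foldr_cons, diffOp]
    split_ifs
    · exact ih α
    · exact (ih α).sub (ih _)

theorem memLp_shiftedDiag {d : ℕ} {Ω : Type*} [MeasurableSpace Ω] {μ : Measure Ω}
    {p : ENNReal} {S : (Fin d → ℕ) → Ω → ℝ} (hS : ∀ α, MemLp (S α) p μ) (m : ℕ) :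
    MemLp (fun ω => shiftedDiag (fun β => S β ω) m) p μ := by
  unfold shiftedDiag
  split_ifs
  · exact MemLp.zero'
  · exact hS _

theorem measurable_shiftedDiag {d : ℕ} (m : ℕ) :
    Measurable fun S : (Fin d → ℕ) → ℝ => shiftedDiag S m := by
  unfold shiftedDiag
  split_ifs <;> fun_prop

/-- Proposition 3.3, finite form: with an `ℕ`-valued `N` independent
of the square-integrable family `(S_α)`, `P(N ≥ m) > 0` for `m ∈ {0,…,n}`, writing
`S̄_m = S_{(m,…,m)}` (and `S̄_{−1} = 0`), the partial estimator
`Z̄'_n = Σ_{α ∈ I_0^n} ΔS_α 1_{N ≥ |α|_∞} / P(N ≥ |α|_∞)` satisfies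
`E[(Z̄'_n)²] = Σ_{α ∈ I_0^n} E[ΔS_α (2S̄_n − S̄_{|α|_∞} − S̄_{|α|_∞−1})] / P(N ≥ |α|_∞)`. -/
theorem secondMoment_diag_estimator {d : ℕ} (hd : 1 ≤ d)
    {Ω : Type*} [MeasureSpace Ω] [IsProbabilityMeasure (ℙ : Measure Ω)]
    (S : (Fin d → ℕ) → Ω → ℝ) (hS : ∀ α, MemLp (S α) 2 ℙ)
    (n : ℕ)
    (N : Ω → ℕ) (hN : Measurable N)
    (hind : IndepFun N (fun ω => fun α => S α ω) ℙ)
    (hpos : ∀ m ≤ n, 0 < ℙ {ω | m ≤ N ω}) :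
    ∫ ω, (∑ α ∈ Finset.Iic ((fun _ => n) : Fin d → ℕ),
        mixedDiff (fun β => S β ω) α
          * Set.indicator {ω' | Finset.univ.sup α ≤ N ω'} 1 ω
          / (ℙ {ω' | Finset.univ.sup α ≤ N ω'}).toReal) ^ 2 ∂ℙ
      = ∑ α ∈ Finset.Iic ((fun _ => n) : Fin d → ℕ),
          (∫ ω, mixedDiff (fun β => S β ω) α
              * (2 * S (fun _ => n) ω - S (fun _ => Finset.univ.sup α) ω
                  - (if Finset.univ.sup α = 0 then 0
                     else S (fun _ => Finset.univ.sup α - 1) ω)) ∂ℙ)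
            / (ℙ {ω | Finset.univ.sup α ≤ N ω}).toReal := by
  set F : Ω → (Fin d → ℕ) → ℝ := fun ω β => S β ω with hF
  set p : ℕ → ℝ := fun m => (ℙ {ω | m ≤ N ω}).toReal with hp
  set D : ℕ → Ω → ℝ := fun m ω => shiftedDiag (F ω) (m + 1) - shiftedDiag (F ω) m with hD
  set J : ℕ → Ω → ℝ := fun m => Set.indicator {ω | m ≤ N ω} 1 with hJ
  set A : ℕ → ℕ → ℝ := fun m k => ∫ ω, D m ω * D k ω ∂ℙ with hA
  have hp0 : ∀ m ∈ Finset.range (n + 1), p m ≠ 0 := fun m hm =>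
    (ENNReal.toReal_pos (hpos m (Nat.lt_succ_iff.1 (Finset.mem_range.1 hm))).ne'
      (measure_ne_top _ _)).ne'
  have hT := memLp_shiftedDiag hS
  have hDL : ∀ m, MemLp (D m) 2 ℙ := fun m => (hT (m + 1)).sub (hT m)
  have hDD : ∀ m k, Integrable (fun ω => D m ω * D k ω) ℙ := fun m k =>
    (hDL m).integrable_mul (hDL k)
  have hNs : ∀ m, MeasurableSet {ω | m ≤ N ω} := fun m => hN measurableSet_Ici
  have hJmeas : ∀ m, Measurable (J m) := fun m => measurable_one.indicator (hNs m)
  have hJint : ∀ m, ∫ ω, J m ω ∂ℙ = p m := fun m => by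
    simp only [hJ, hp]
    rw [integral_indicator_one (hNs m)]
    rfl
  have hJJ : ∀ m k ω, J m ω * J k ω = J (max m k) ω := fun m k ω => by
    simp only [hJ, Set.indicator_apply, Set.mem_ofPred_eq, max_le_iff, Pi.one_apply]
    split_ifs <;> simp_all
  have hDJ : ∀ m k, Integrable (fun ω => D m ω * D k ω * J (max m k) ω) ℙ := fun m k => by
    refine (hDD m k).mul_bdd (c := 1) (hJmeas _).aestronglyMeasurable (.of_forall fun ω => ?_)
    simp only [hJ, Set.indicator_apply]
    split_ifs <;> simp
  have hE : ∀ m k, ∫ ω, D m ω * D k ω * J (max m k) ω ∂ℙ = A m k * p (max m k) := fun m k => by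
    rw [← hJint]
    refine IndepFun.integral_fun_mul_eq_mul_integral ?_ (hDD m k).aestronglyMeasurable
      (hJmeas _).aestronglyMeasurable
    have hφ : Measurable fun x : (Fin d → ℕ) → ℝ =>
        (shiftedDiag x (m + 1) - shiftedDiag x m) * (shiftedDiag x (k + 1) - shiftedDiag x k) :=
      ((measurable_shiftedDiag _).sub (measurable_shiftedDiag _)).mul
        ((measurable_shiftedDiag _).sub (measurable_shiftedDiag _))
    exact hind.symm.comp hφ (measurable_of_countable (Set.indicator (Set.Ici (max m k)) 1))
  have hL : ∀ ω, (∑ α ∈ Finset.Iic ((fun _ => n) : Fin d → ℕ),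
        mixedDiff (F ω) α * J (Finset.univ.sup α) ω / p (Finset.univ.sup α)) ^ 2
      = ∑ m ∈ Finset.range (n + 1), ∑ k ∈ Finset.range (n + 1),
          D m ω * D k ω * J (max m k) ω / (p m * p k) := fun ω => by
    simp only [mul_div_assoc]
    rw [sum_mixedDiff_mul_sup (F ω) n fun m => J m ω / p m, sq, Finset.sum_mul_sum]
    refine Finset.sum_congr rfl fun m _ => Finset.sum_congr rfl fun k _ => ?_
    rw [← hJJ]
    simp only [hD]
    ring
  have hR : ∀ m ∈ Finset.range (n + 1), (∫ ω, D m ω * (2 * shiftedDiag (F ω) (n + 1)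
        - shiftedDiag (F ω) (m + 1) - shiftedDiag (F ω) m) ∂ℙ)
      = A m m + 2 * ∑ k ∈ Finset.Ico (m + 1) (n + 1), A m k := fun m hm => by
    have hsum : ∀ ω, D m ω * (2 * shiftedDiag (F ω) (n + 1)
          - shiftedDiag (F ω) (m + 1) - shiftedDiag (F ω) m)
        = D m ω * D m ω + 2 * ∑ k ∈ Finset.Ico (m + 1) (n + 1), D m ω * D k ω := fun ω => by
      rw [← Finset.mul_sum]
      simp only [hD]
      rw [Finset.sum_Ico_sub (shiftedDiag (F ω)) (Nat.succ_le_of_lt (Finset.mem_range.1 hm))]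
      ring
    simp only [hsum]
    rw [integral_add (hDD m m) ((integrable_finsetSum _ fun k _ => hDD m k).const_mul 2),
      integral_const_mul, integral_finsetSum _ fun k _ => hDD m k]
  have hG : ∀ m, MemLp (fun ω => 2 * shiftedDiag (F ω) (n + 1)
      - shiftedDiag (F ω) (m + 1) - shiftedDiag (F ω) m) 2 ℙ := fun m =>
    (((hT (n + 1)).const_mul 2).sub (hT (m + 1))).sub (hT m)
  have hRI : ∑ α ∈ Finset.Iic ((fun _ => n) : Fin d → ℕ),
        (∫ ω, mixedDiff (F ω) α * (2 * shiftedDiag (F ω) (n + 1)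
          - shiftedDiag (F ω) (Finset.univ.sup α + 1)
          - shiftedDiag (F ω) (Finset.univ.sup α)) ∂ℙ) / p (Finset.univ.sup α)
      = ∑ m ∈ Finset.range (n + 1), (∫ ω, D m ω * (2 * shiftedDiag (F ω) (n + 1)
          - shiftedDiag (F ω) (m + 1) - shiftedDiag (F ω) m) ∂ℙ) / p m := by
    have hI : ∀ α, Integrable (fun ω => mixedDiff (F ω) α * (2 * shiftedDiag (F ω) (n + 1)
        - shiftedDiag (F ω) (Finset.univ.sup α + 1) - shiftedDiag (F ω) (Finset.univ.sup α))) ℙ :=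
      fun α => (memLp_mixedDiff hS α).integrable_mul (hG _)
    have hI' : ∀ m, Integrable (fun ω => D m ω * (2 * shiftedDiag (F ω) (n + 1)
        - shiftedDiag (F ω) (m + 1) - shiftedDiag (F ω) m)) ℙ :=
      fun m => (hDL m).integrable_mul (hG m)
    simp only [← integral_div]
    rw [← integral_finsetSum _ fun α _ => (hI α).div_const _,
      ← integral_finsetSum _ fun m _ => (hI' m).div_const _]
    refine integral_congr_ae (.of_forall fun ω => ?_)
    simp only [mul_div_assoc]
    exact sum_mixedDiff_mul_sup (F ω) n fun m => (2 * shiftedDiag (F ω) (n + 1)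
      - shiftedDiag (F ω) (m + 1) - shiftedDiag (F ω) m) / p m
  calc _ = ∑ m ∈ Finset.range (n + 1), ∑ k ∈ Finset.range (n + 1), A m k / p (min m k) := by
        refine (integral_congr_ae (.of_forall hL)).trans ?_
        rw [integral_finsetSum _ fun m _ =>
          integrable_finsetSum _ fun k _ => (hDJ m k).div_const _]
        refine Finset.sum_congr rfl fun m hm => ?_
        rw [integral_finsetSum _ fun k _ => (hDJ m k).div_const _]
        refine Finset.sum_congr rfl fun k hk => ?_
        rw [integral_div, hE]
        have hm0 := hp0 m hm
        have hk0 := hp0 k hk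
        rcases le_total m k with h | h
        · rw [max_eq_right h, min_eq_left h]; field_simp
        · rw [max_eq_left h, min_eq_right h]; field_simp
    _ = ∑ m ∈ Finset.range (n + 1),
          (A m m + 2 * ∑ k ∈ Finset.Ico (m + 1) (n + 1), A m k) / p m :=
        sum_symm_div_min (fun m k => by simp only [hA, mul_comm]) p (n + 1)
    _ = _ := by
        rw [← Finset.sum_congr rfl fun m hm => congrArg (· / p m) (hR m hm), ← hRI]
        simp [shiftedDiag, hF, hp]
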